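/- arXiv:2412.18001 — 2 statements merged into one kernel-verified Lean document; each statement's English description precedes it below -/
import Mathlib

section
/- For any point x of G and any shortest path tree T of x (rooted at the vertex, possibly dummy, containing x), every neutral vertex of x is either a leaf of T or an internal node of T all of whose descendants in T are neutral vertices of x. -/
namespace KCenter

/-- A connected undirected graph network: each vertex `v` has a positive weight `w v`
and each edge `{u,v}` has a positive length `len u v`. -/
structure Net (V : Type) [Fintype V] [DecidableEq V] where
  G : SimpleGraph V
  conn : G.Connected
  w : V → ℝ
  w_pos : ∀ v, 0 < w v
  len : V → V → ℝ
  len_symm : ∀ u v, len u v = len v u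
  len_pos : ∀ u v, G.Adj u v → 0 < len u v

variable {V : Type} [Fintype V] [DecidableEq V]

/-- The length of a walk: the sum of the lengths of its edges. -/
noncomputable def wlen (N : Net V) {u v : V} (p : N.G.Walk u v) : ℝ :=
  (p.edges.map (Sym2.lift ⟨N.len, N.len_symm⟩)).sum

/-- The shortest-path distance between two vertices. -/
noncomputable def dV (N : Net V) (u v : V) : ℝ :=
  sInf {r : ℝ | ∃ p : N.G.Walk u v, wlen N p = r}

/-- A point of the graph: it lies on the edge `e(u,v)` at distance `t` from `u`
(with `0 ≤ t ≤ len u v`). -/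
structure Pt (N : Net V) where
  u : V
  v : V
  adj : N.G.Adj u v
  t : ℝ
  ht0 : 0 ≤ t
  ht1 : t ≤ N.len u v

/-- The length of the edge a point lies on. -/
noncomputable def elen {N : Net V} (x : Pt N) : ℝ := N.len x.u x.v

/-- The shortest-path distance from a point to a vertex. -/
noncomputable def dP (N : Net V) (x : Pt N) (a : V) : ℝ :=
  min (x.t + dV N x.u a) ((elen x - x.t) + dV N x.v a)

/-- `par` encodes a shortest path tree of the point `x`, rooted at the (possibly dummy)
vertex containing `x`: `par a = none` means `a` is attached directly to `x` along the edge
containing `x`, and `par a = some b` means `b` is the tree parent of `a`; in both cases the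
tree path from `x` to `a` is a shortest path. -/
def IsSPT (N : Net V) (x : Pt N) (par : V → Option V) : Prop :=
  ∀ a : V,
    (par a = none →
      (a = x.u ∧ dP N x a = x.t) ∨ (a = x.v ∧ dP N x a = elen x - x.t)) ∧
    (∀ b : V, par a = some b → N.G.Adj b a ∧ dP N x b + N.len b a = dP N x a)

/-- Adjacency in the shortest path tree encoded by `par` (among real vertices). -/
def tAdj (par : V → Option V) (a b : V) : Prop := par a = some b ∨ par b = some a

/-- A set `S` of vertices is connected under the relation `r` using only vertices of `S`. -/
def ConnIn (r : V → V → Prop) (S : Set V) : Prop :=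
  ∀ a ∈ S, ∀ b ∈ S, Relation.ReflTransGen (fun p q => q ∈ S ∧ r p q) a b

/-- `S` is (the vertex set of) a `k`-subtree of a shortest path tree of `x`,
i.e. `S` has `k` vertices and is connected inside some shortest path tree of `x`. -/
def IsKSub (N : Net V) (k : ℕ) (x : Pt N) (S : Set V) : Prop :=
  S.ncard = k ∧ ∃ par : V → Option V, IsSPT N x par ∧ ConnIn (tAdj par) S

/-- `max_{v ∈ S} w v * d(x,v)`. -/
noncomputable def mval (N : Net V) (x : Pt N) (S : Set V) : ℝ :=
  sSup {y : ℝ | ∃ v ∈ S, y = N.w v * dP N x v}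

/-- The set of objective values `max_{v∈T^k} w_v d(x,v)` over all points `x` of `G` and all
`k`-subtrees `T^k` of shortest path trees of `x`; its least element is `λ* = min_x φ(x,G)`. -/
def vals (N : Net V) (k : ℕ) : Set ℝ :=
  {y : ℝ | ∃ (x : Pt N) (S : Set V), IsKSub N k x S ∧ y = mval N x S}

/-- The point `x` is a point of the subtree with vertex set `S`:
it is located at a vertex of `S`, or interior of an edge with both endpoints in `S`. -/
def PtOn (N : Net V) (x : Pt N) (S : Set V) : Prop :=
  (x.t = 0 ∧ x.u ∈ S) ∨ (x.t = elen x ∧ x.v ∈ S) ∨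
  (0 < x.t ∧ x.t < elen x ∧ x.u ∈ S ∧ x.v ∈ S)

/-- `a` is a neutral vertex of `x` (equivalently, `x` is the semicircular point of `a` on
the edge containing `x`). -/
def Neutral (N : Net V) (x : Pt N) (a : V) : Prop :=
  dV N a x.u + x.t = dV N a x.v + (elen x - x.t)

/-- `V_r(x)`: vertices strictly on the `x.u`-side of `x`. -/
def Vr (N : Net V) (x : Pt N) : Set V :=
  {a | dV N a x.u + x.t < dV N a x.v + (elen x - x.t)}

/-- `V_s(x)`: vertices strictly on the `x.v`-side of `x`. -/
def Vs (N : Net V) (x : Pt N) : Set V :=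
  {a | dV N a x.v + (elen x - x.t) < dV N a x.u + x.t}

/-- `V̄(x)`: the set of neutral vertices of `x`. -/
def NbarSet (N : Net V) (x : Pt N) : Set V := {a | Neutral N x a}

/-- `Λ`: the local one-center objective values; for an edge `e(r,s)` and two distinct
vertices `u ≠ v`, the value of an intersection of the increasing branch of `D(u,·)`
with the decreasing branch of `D(v,·)` at a point of `e(r,s)`. -/
def Lam1 (N : Net V) : Set ℝ :=
  {y : ℝ | ∃ r s : V, N.G.Adj r s ∧ ∃ u v : V, u ≠ v ∧ ∃ t : ℝ,
    0 ≤ t ∧ t ≤ N.len r s ∧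
    dV N u r + t ≤ dV N u s + (N.len r s - t) ∧
    dV N v s + (N.len r s - t) ≤ dV N v r + t ∧
    N.w u * (dV N u r + t) = y ∧ N.w v * (dV N v s + (N.len r s - t)) = y}

/-- `Λ'`: the values `w_v · d(v, x')` over all vertices `v` and all semicircular points `x'`
(of any vertex `u`) on edges of `G`. -/
def Lam2 (N : Net V) : Set ℝ :=
  {y : ℝ | ∃ v u r s : V, N.G.Adj r s ∧ ∃ t : ℝ,
    0 ≤ t ∧ t ≤ N.len r s ∧
    dV N u r + t = dV N u s + (N.len r s - t) ∧
    y = N.w v * min (t + dV N r v) ((N.len r s - t) + dV N s v)}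

/-- `S` is (the vertex set of) a `k`-subtree of `G`. -/
def KSubG (N : Net V) (k : ℕ) (S : Set V) : Prop :=
  S.ncard = k ∧ ConnIn N.G.Adj S

/-- The weighted diameter `W(G') = max_{u,v∈V(G')} w_u w_v d(u,v)/(w_u+w_v)`. -/
noncomputable def Wd (N : Net V) (S : Set V) : ℝ :=
  sSup {y : ℝ | ∃ u ∈ S, ∃ v ∈ S, y = N.w u * N.w v * dV N u v / (N.w u + N.w v)}

/-- The subtree with vertex set `S` is covered by the point `x` under `lam`. -/
def Covered (N : Net V) (lam : ℝ) (x : Pt N) (S : Set V) : Prop :=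
  ∀ v ∈ S, N.w v * dP N x v ≤ lam

/-- The vertex `a` is the (real) vertex at which the point `x` is located. -/
def AtX (N : Net V) (x : Pt N) (a : V) : Prop :=
  (x.t = 0 ∧ a = x.u) ∨ (x.t = elen x ∧ a = x.v)

/-- `S` together with `x` induces a connected subtree of the shortest path tree `par` of `x`:
`S` is closed under tree parents, up to the root `x`. -/
def SelfIncl (N : Net V) (x : Pt N) (par : V → Option V) (S : Set V) : Prop :=
  ∀ a ∈ S, ∀ b : V, par a = some b → b ∈ S ∨ AtX N x b

/-- `S` is a covered self-inclusive subtree of `x` under `lam`. -/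
def CSI (N : Net V) (lam : ℝ) (x : Pt N) (S : Set V) : Prop :=
  ∃ par : V → Option V, IsSPT N x par ∧ SelfIncl N x par S ∧ Covered N lam x S

/-- `a` is a heavy vertex of `x`: it cannot be covered by `x` under `lam`. -/
def Heavy (N : Net V) (lam : ℝ) (x : Pt N) (a : V) : Prop := lam < N.w a * dP N x a

/-- The walk `p` (from `a` to an endpoint of the edge containing `x`), extended by the
corresponding segment to `x`, is a shortest path from `a` to `x`. -/
def ShortestToX (N : Net V) (x : Pt N) {a b : V} (p : N.G.Walk a b) : Prop :=
  (b = x.u ∧ wlen N p + x.t = dP N x a) ∨ (b = x.v ∧ wlen N p + (elen x - x.t) = dP N x a)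

/-- `a` is a descendant of the set `S` w.r.t. `x`: every shortest path from `a` to `x`
contains a vertex of `S`. -/
def DescOf (N : Net V) (x : Pt N) (S : Set V) (a : V) : Prop :=
  ∀ (b : V) (p : N.G.Walk a b), ShortestToX N x p → ∃ c ∈ p.support, c ∈ S

/-- `a` is a light vertex of `x`: it is neither heavy nor a descendant of the set of heavy
vertices of `x`. -/
def Light (N : Net V) (lam : ℝ) (x : Pt N) (a : V) : Prop :=
  ¬ Heavy N lam x a ∧ ¬ DescOf N x {c | Heavy N lam x c} a

/-- `f(e,x) = |V(T_λ(x))|`: the maximum cardinality of a covered self-inclusive subtree of `x`. -/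
noncomputable def fval (N : Net V) (lam : ℝ) (x : Pt N) : ℕ :=
  sSup {c : ℕ | ∃ S : Set V, CSI N lam x S ∧ S.ncard = c}

/-- `a` is light by `r = x.u` w.r.t. `x`: it has a shortest path to `x` through the segment
between `r` and `x` that contains no heavy vertex of `x`. -/
def LightByR (N : Net V) (lam : ℝ) (x : Pt N) (a : V) : Prop :=
  ∃ p : N.G.Walk a x.u, wlen N p + x.t = dP N x a ∧ ∀ c ∈ p.support, ¬ Heavy N lam x c

/-- `a` is light by `s = x.v` w.r.t. `x`. -/
def LightByS (N : Net V) (lam : ℝ) (x : Pt N) (a : V) : Prop :=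
  ∃ p : N.G.Walk a x.v, wlen N p + (elen x - x.t) = dP N x a ∧ ∀ c ∈ p.support, ¬ Heavy N lam x c

/-- `Q_r(x)`: the light-by-`r` vertices of `x` in `V_r(x)` together with the neutral vertices
of `x` that are light by `r`. -/
def Qr (N : Net V) (lam : ℝ) (x : Pt N) : Set V :=
  {a | dV N a x.u + x.t ≤ dV N a x.v + (elen x - x.t) ∧ LightByR N lam x a}

/-- `Q_s(x)`: the light-by-`s` vertices of `x` in `V_s(x)` together with the neutral vertices
of `x` that are light by `s`. -/
def Qs (N : Net V) (lam : ℝ) (x : Pt N) : Set V :=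
  {a | dV N a x.v + (elen x - x.t) ≤ dV N a x.u + x.t ∧ LightByS N lam x a}

/-- In a tree, the point `x` lies on the path from the vertex `v` to the vertex `root`. -/
def OnPathToRoot (N : Net V) (root v : V) (x : Pt N) : Prop :=
  dP N x v + dP N x root = dV N v root

/-- `x` is the critical point of the vertex `v` w.r.t. `root`: it lies on the path from `v`
to `root`; it satisfies `w_v · d(v,x) = λ` when this equation has a solution on the path
(i.e. when `λ ≤ w_v · d(v,root)`), and it is the root otherwise. -/
def CritPt (N : Net V) (lam : ℝ) (root v : V) (x : Pt N) : Prop :=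
  OnPathToRoot N root v x ∧
    ((lam ≤ N.w v * dV N v root ∧ N.w v * dP N x v = lam) ∨
     (N.w v * dV N v root < lam ∧ dP N x root = 0))


theorem wlen_nonneg (N : Net V) {u v : V} (p : N.G.Walk u v) : 0 ≤ wlen N p := by
  refine List.sum_nonneg fun r hr => ?_
  obtain ⟨e, he, rfl⟩ := List.mem_map.1 hr
  induction e with
  | _ a b => exact (N.len_pos a b (p.adj_of_mem_edges he)).le

theorem wlen_reverse (N : Net V) {u v : V} (p : N.G.Walk u v) :
    wlen N p.reverse = wlen N p := by
  simp [wlen, List.map_reverse, List.sum_reverse]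

theorem wlen_cons (N : Net V) {a b u : V} (h : N.G.Adj a b) (p : N.G.Walk b u) :
    wlen N (SimpleGraph.Walk.cons h p) = N.len a b + wlen N p := by
  simp [wlen]

theorem dV_le_wlen (N : Net V) {u v : V} (p : N.G.Walk u v) : dV N u v ≤ wlen N p :=
  csInf_le ⟨0, by rintro _ ⟨q, rfl⟩; exact wlen_nonneg N q⟩ ⟨p, rfl⟩

theorem le_dV (N : Net V) {u v : V} {r : ℝ} (h : ∀ p : N.G.Walk u v, r ≤ wlen N p) :
    r ≤ dV N u v := by
  obtain ⟨p⟩ := N.conn.preconnected u v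
  exact le_csInf ⟨_, p, rfl⟩ (by rintro _ ⟨q, rfl⟩; exact h q)

theorem dV_comm (N : Net V) (u v : V) : dV N u v = dV N v u := by
  apply le_antisymm <;> exact le_dV N fun p => wlen_reverse N p ▸ dV_le_wlen N p.reverse

theorem dV_le_len_add (N : Net V) {a b : V} (h : N.G.Adj a b) (u : V) :
    dV N a u ≤ N.len a b + dV N b u := by
  rw [← sub_le_iff_le_add']
  refine le_dV N fun p => ?_
  rw [sub_le_iff_le_add', ← wlen_cons N h p]
  exact dV_le_wlen N _

theorem dP_eq_min (N : Net V) (x : Pt N) (a : V) :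
    dP N x a = min (dV N a x.u + x.t) (dV N a x.v + (elen x - x.t)) := by
  rw [dP, dV_comm N x.u, dV_comm N x.v, add_comm x.t, add_comm (elen x - x.t)]

theorem IsSPT.neutral_of_parent {N : Net V} {x : Pt N} {par : V → Option V}
    (hpar : IsSPT N x par) {a b : V} (h : par a = some b) (hb : Neutral N x b) :
    Neutral N x a := by
  obtain ⟨hadj, hd⟩ := (hpar a).2 b h
  have hu := dV_le_len_add N hadj.symm x.u
  have hv := dV_le_len_add N hadj.symm x.v
  rw [N.len_symm a b] at hu hv
  unfold Neutral at hb ⊢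
  rw [dP_eq_min, dP_eq_min, ← hb, min_self] at hd
  have hau := hd.trans_le (min_le_left _ _)
  have hav := hd.trans_le (min_le_right _ _)
  linarith

/-- For any point `x` of `G` and any shortest path tree `T` of `x`,
every neutral vertex of `x` is either a leaf of `T` or an internal node of `T` all of
whose descendants in `T` are neutral vertices of `x`. -/
theorem stmt3 {V : Type} [Fintype V] [DecidableEq V] (N : Net V)
    (x : Pt N) (par : V → Option V) (hpar : IsSPT N x par)
    (v : V) (hv : Neutral N x v) :
    (∀ u : V, par u ≠ some v) ∨
    (∀ u : V, Relation.TransGen (fun a b => par a = some b) u v → Neutral N x u) := by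
  refine Or.inr fun u h => ?_
  induction h using Relation.TransGen.head_induction_on with
  | single h => exact hpar.neutral_of_parent h hv
  | head h _ ih => exact hpar.neutral_of_parent h ih

end KCenter
end

section
/- Let C be a set of n x-monotone polygonal chains over the interval [0,l], each chain being either a single line segment of slope +1 or −1, or a segment of slope +1 followed by a segment of slope −1. Then the generalized k-th level C^k of C is an x-monotone polygonal chain consisting of at most 2n line segments. -/
namespace KLevelGeom

/-- A chain: the graph over `x` of `min (a + x) (b - x)`.  On an interval `[0,l]`, such a
function is exactly an `x`-monotone polygonal chain that is either a single segment of
slope `+1`, a single segment of slope `−1`, or a segment of slope `+1` followed by a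
segment of slope `−1`. -/
noncomputable def chain (a b x : ℝ) : ℝ := min (a + x) (b - x)

/-- The number of chains of the family `f` that are not above the point `(x, y)`,
i.e. the number of chains intersected by the downward-directed vertical ray from `(x,y)`
(together with the chains through `(x,y)` itself). -/
noncomputable def belowCount (n : ℕ) (f : Fin n → ℝ → ℝ) (x y : ℝ) : ℕ :=
  {i : Fin n | f i x ≤ y}.ncard

/-- The generalized `k`-th level of the family of chains `f` over `[0,l]`: the closure of
the set of all points lying on chains such that the downward-directed vertical ray
emanating from the point meets the fewest possible but at least `k` chains. -/
noncomputable def KLevel (n k : ℕ) (l : ℝ) (f : Fin n → ℝ → ℝ) : Set (ℝ × ℝ) :=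
  closure {p : ℝ × ℝ | p.1 ∈ Set.Icc 0 l ∧ (∃ i, f i p.1 = p.2) ∧
    k ≤ belowCount n f p.1 p.2 ∧
    ∀ y' : ℝ, (∃ i, f i p.1 = y') → k ≤ belowCount n f p.1 y' →
      belowCount n f p.1 p.2 ≤ belowCount n f p.1 y'}

/-- If finitely many order-connected closed sets cover `[u, l]`, then `[u, l]` can be cut into at
most as many consecutive intervals, each of which is contained in one of the sets. -/
theorem exists_partition_of_cover {ι : Type*} [DecidableEq ι] {S : ι → Set ℝ}
    (hS : ∀ i, IsClosed (S i)) (hc : ∀ i, (S i).OrdConnected) {l : ℝ} (s : Finset ι) :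
    ∀ u < l, Set.Icc u l ⊆ ⋃ i ∈ s, S i →
      ∃ m : ℕ, 1 ≤ m ∧ m ≤ s.card ∧ ∃ (ξ : ℕ → ℝ) (t : ℕ → ι),
        ξ 0 = u ∧ ξ m = l ∧ (∀ j < m, ξ j < ξ (j + 1)) ∧
        (∀ x, x ∈ Set.Icc u l ↔ ∃ j < m, x ∈ Set.Icc (ξ j) (ξ (j + 1))) ∧
        ∀ j < m, Set.Icc (ξ j) (ξ (j + 1)) ⊆ S (t j) := by
  induction s using Finset.strongInduction with
  | H s ih =>
  intro u hu hcov
  obtain ⟨i, his, hui⟩ : ∃ i ∈ s, u ∈ closure (S i ∩ Set.Ioc u l) := by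
    have h1 : u ∈ closure (⋃ i ∈ s, S i ∩ Set.Ioc u l) := by
      have h2 : u ∈ closure (Set.Ioc u l) := by
        rw [closure_Ioc hu.ne]
        exact ⟨le_rfl, hu.le⟩
      refine closure_mono (fun x hx => ?_) h2
      have := hcov ⟨hx.1.le, hx.2⟩
      simp only [Set.mem_iUnion] at this ⊢
      obtain ⟨i, hi, hx'⟩ := this
      exact ⟨i, hi, hx', hx⟩
    rw [Finset.closure_biUnion] at h1
    simpa using h1
  have huS : u ∈ S i := (hS i).closure_subset_iff.2 Set.inter_subset_left hui
  obtain ⟨w, hwS, hw⟩ := closure_nonempty_iff.1 ⟨u, hui⟩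
  obtain ⟨v, ⟨hvS, -, hvl⟩, hvmax⟩ :=
    (isCompact_Icc.inter_left (hS i) : IsCompact (S i ∩ Set.Icc u l)).exists_isGreatest
      ⟨w, hwS, hw.1.le, hw.2⟩
  have huv : u < v := hw.1.trans_le (hvmax ⟨hwS, hw.1.le, hw.2⟩)
  have hsub : Set.Icc u v ⊆ S i := (hc i).out huS hvS
  have hcard : 1 ≤ s.card := Finset.card_pos.2 ⟨i, his⟩
  rcases hvl.eq_or_lt with rfl | hvl
  · refine ⟨1, le_rfl, hcard, fun j => if j = 0 then u else v, fun _ => i, ?_⟩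
    simpa [huv] using hsub
  · have hcov' : Set.Icc v l ⊆ ⋃ j ∈ s.erase i, S j := by
      rw [← closure_Ioc hvl.ne]
      refine closure_minimal (fun x hx => ?_) (isClosed_biUnion_finset fun j _ => hS j)
      have hxu : x ∈ Set.Icc u l := ⟨huv.le.trans hx.1.le, hx.2⟩
      have := hcov hxu
      simp only [Set.mem_iUnion] at this ⊢
      obtain ⟨j, hj, hxj⟩ := this
      refine ⟨j, Finset.mem_erase.2 ⟨?_, hj⟩, hxj⟩
      rintro rfl
      exact absurd (hvmax ⟨hxj, hxu⟩) (not_le.2 hx.1)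
    obtain ⟨m, -, hm, ξ, t, h0, hml, hlt, hx, ht⟩ :=
      ih _ (Finset.erase_ssubset his) v hvl hcov'
    rw [Finset.card_erase_of_mem his] at hm
    refine ⟨m + 1, by omega, by omega, fun j => Nat.casesOn j u ξ, fun j => Nat.casesOn j i t,
      rfl, hml, ?_, ?_, ?_⟩
    · rintro (_ | j) hj
      · simpa [h0] using huv
      · exact hlt j (by omega)
    · intro x
      constructor
      · intro h
        rcases le_total x v with hxv | hxv
        · exact ⟨0, by omega, h.1, by simpa [h0] using hxv⟩
        · obtain ⟨j, hj, hxj⟩ := (hx x).1 ⟨hxv, h.2⟩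
          exact ⟨j + 1, by omega, hxj⟩
      · rintro ⟨_ | j, hj, hxj⟩
        · have h2 : x ≤ v := by simpa [h0] using hxj.2
          exact ⟨hxj.1, h2.trans hvl.le⟩
        · have := (hx x).2 ⟨j, by omega, hxj⟩
          exact ⟨huv.le.trans this.1, this.2⟩
    · rintro (_ | j) hj
      · simpa [h0] using hsub
      · exact ht j (by omega)

theorem belowCount_mono {n : ℕ} (f : Fin n → ℝ → ℝ) {x x' y y' : ℝ}
    (h : ∀ i, f i x ≤ y → f i x' ≤ y') : belowCount n f x y ≤ belowCount n f x' y' :=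
  Set.ncard_le_ncard h (Set.toFinite _)

theorem belowCount_lt {n : ℕ} (f : Fin n → ℝ → ℝ) {x y : ℝ} (i : Fin n) (h : y < f i x) :
    belowCount n f x y < belowCount n f x (f i x) := by
  refine Set.ncard_lt_ncard ?_ (Set.toFinite _)
  refine (Set.ssubset_iff_of_subset fun j (hj : f j x ≤ y) => hj.trans h.le).2 ⟨i, le_refl (f i x), ?_⟩
  exact not_le.2 h

/-- The `k`-th order statistic of a family of functions. -/
theorem exists_order_statistic {n k : ℕ} (hk : 1 ≤ k) (hkn : k ≤ n) (f : Fin n → ℝ → ℝ) (x : ℝ) :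
    ∃ g : ℝ, (∃ i, f i x = g) ∧ ∀ y, g ≤ y ↔ k ≤ belowCount n f x y := by
  have key : ∀ y, k ≤ belowCount n f x y →
      ∃ i, f i x ≤ y ∧ k ≤ belowCount n f x (f i x) := by
    intro y hy
    have hne : {i : Fin n | f i x ≤ y}.Nonempty :=
      (Set.ncard_pos (Set.toFinite _)).1 (hk.trans hy)
    obtain ⟨i, hi, hmax⟩ := Set.exists_max_image _ (fun i => f i x) (Set.toFinite _) hne
    exact ⟨i, hi, hy.trans (belowCount_mono f fun j hj => hmax j hj)⟩
  have hne : {i : Fin n | k ≤ belowCount n f x (f i x)}.Nonempty := by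
    have : Nonempty (Fin n) := ⟨⟨0, by omega⟩⟩
    obtain ⟨i, hi⟩ := Finite.exists_max fun i => f i x
    refine ⟨i, ?_⟩
    have : {j : Fin n | f j x ≤ f i x} = Set.univ := Set.eq_univ_of_forall hi
    simpa [belowCount, this, Set.ncard_univ] using hkn
  obtain ⟨i, hi, hmin⟩ := Set.exists_min_image _ (fun i => f i x) (Set.toFinite _) hne
  refine ⟨f i x, ⟨i, rfl⟩, fun y => ⟨fun h => ?_, fun h => ?_⟩⟩
  · exact le_trans hi (belowCount_mono f fun j hj => hj.trans h)
  · obtain ⟨j, hjy, hj⟩ := key y h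
    exact (hmin j hj).trans hjy

theorem chain_le_add (a b x x' : ℝ) : chain a b x' ≤ chain a b x + |x' - x| := by
  have h1 := le_abs_self (x' - x)
  have h2 := neg_abs_le (x' - x)
  unfold chain
  rcases min_cases (a + x) (b - x) with ⟨h, -⟩ | ⟨h, -⟩ <;> rw [h]
  · exact (min_le_left _ _).trans (by linarith)
  · exact (min_le_right _ _).trans (by linarith)

/-- The generalized level is the graph of the order statistic when the latter is continuous. -/
theorem kLevel_eq_graph {n k : ℕ} {l : ℝ} {f : Fin n → ℝ → ℝ} {g : ℝ → ℝ} (hg : Continuous g)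
    (hgf : ∀ x, ∃ i, f i x = g x) (hgk : ∀ x y, g x ≤ y ↔ k ≤ belowCount n f x y) :
    KLevel n k l f = {p : ℝ × ℝ | p.1 ∈ Set.Icc 0 l ∧ p.2 = g p.1} := by
  have hclosed : IsClosed {p : ℝ × ℝ | p.1 ∈ Set.Icc 0 l ∧ p.2 = g p.1} :=
    (isClosed_Icc.preimage continuous_fst).inter
      (isClosed_eq continuous_snd (hg.comp continuous_fst))
  rw [← hclosed.closure_eq, KLevel]
  congr 1
  ext ⟨x, y⟩
  refine and_congr_right fun _ => ⟨?_, ?_⟩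
  · rintro ⟨⟨i, hi⟩, hky, hmin⟩
    dsimp only at hi hky hmin ⊢
    refine le_antisymm (not_lt.1 fun hlt => ?_) ((hgk x y).2 hky)
    subst hi
    exact absurd (hmin _ (hgf x) ((hgk x _).1 le_rfl)) (not_le.2 (belowCount_lt f i hlt))
  · intro h
    dsimp only at h ⊢
    subst h
    refine ⟨hgf x, (hgk x _).1 le_rfl, fun y' _ hy' => ?_⟩
    exact belowCount_mono f fun i hi => hi.trans ((hgk x y').2 hy')

/-- Let `C` be a set of `n` `x`-monotone polygonal chains over `[0,l]`,
each chain being either a single line segment of slope `+1` or `−1`, or a segment of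
slope `+1` followed by a segment of slope `−1`.  Then the generalized `k`-th level `C^k`
of `C` is an `x`-monotone polygonal chain consisting of at most `2n` line segments. -/
theorem stmt15 (n k : ℕ) (hk : 1 ≤ k) (hkn : k ≤ n) (l : ℝ) (hl : 0 < l)
    (a b : Fin n → ℝ) :
    ∃ m : ℕ, 1 ≤ m ∧ m ≤ 2 * n ∧
      ∃ (ξ sl c : ℕ → ℝ),
        ξ 0 = 0 ∧ ξ m = l ∧ (∀ j < m, ξ j < ξ (j + 1)) ∧
        (∀ j : ℕ, j + 1 < m → sl j * ξ (j + 1) + c j = sl (j + 1) * ξ (j + 1) + c (j + 1)) ∧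
        KLevel n k l (fun i x => chain (a i) (b i) x) =
          ⋃ j ∈ Finset.range m,
            {p : ℝ × ℝ | p.1 ∈ Set.Icc (ξ j) (ξ (j + 1)) ∧ p.2 = sl j * p.1 + c j} := by
  choose g hgf hgk using exists_order_statistic hk hkn fun i x => chain (a i) (b i) x
  have hlip : ∀ x x', g x' ≤ g x + |x' - x| := fun x x' =>
    (hgk x' _).2 (((hgk x _).1 le_rfl).trans (belowCount_mono _ fun i hi =>
      (chain_le_add _ _ x x').trans (by simpa using hi)))
  have hg : Continuous g :=
    (LipschitzWith.of_le_add fun x y => by simpa [Real.dist_eq] using hlip y x).continuous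
  have hanti : Antitone fun x => g x - x := fun x y hxy => by
    have := hlip x y
    rw [abs_of_nonneg (sub_nonneg.2 hxy)] at this
    dsimp only
    linarith
  have hmono : Monotone fun x => g x + x := fun x y hxy => by
    have := hlip y x
    rw [abs_of_nonpos (sub_nonpos.2 hxy)] at this
    dsimp only
    linarith
  let S : Fin n ⊕ Fin n → Set ℝ :=
    Sum.elim (fun i => {x | g x - x = a i}) fun i => {x | g x + x = b i}
  have hS : ∀ i, IsClosed (S i) := by
    rintro (i | i)
    · exact isClosed_eq (hg.sub continuous_id) continuous_const
    · exact isClosed_eq (hg.add continuous_id) continuous_const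
  have hc : ∀ i, (S i).OrdConnected := by
    rintro (i | i)
    · exact (Set.ordConnected_singleton (a := a i)).preimage_anti hanti
    · exact (Set.ordConnected_singleton (a := b i)).preimage_mono hmono
  have hcov : Set.Icc 0 l ⊆ ⋃ i ∈ (Finset.univ : Finset (Fin n ⊕ Fin n)), S i := by
    intro x _
    obtain ⟨i, hi⟩ := hgf x
    simp only [Set.mem_iUnion]
    rcases min_choice (a i + x) (b i - x) with h | h
    · exact ⟨Sum.inl i, Finset.mem_univ _, by rw [← chain, hi] at h; simp [S, h]⟩
    · exact ⟨Sum.inr i, Finset.mem_univ _, by rw [← chain, hi] at h; simp [S, h]⟩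
  obtain ⟨m, hm1, hm, ξ, t, h0, hml, hlt, hx, ht⟩ :=
    exists_partition_of_cover hS hc Finset.univ 0 hl hcov
  let sl : Fin n ⊕ Fin n → ℝ := Sum.elim (fun _ => 1) fun _ => -1
  let c : Fin n ⊕ Fin n → ℝ := Sum.elim a b
  have haff : ∀ i, ∀ x ∈ S i, g x = sl i * x + c i := by
    rintro (i | i) x hx
    · have : g x - x = a i := hx
      simp only [sl, c, Sum.elim_inl]
      linarith
    · have : g x + x = b i := hx
      simp only [sl, c, Sum.elim_inr]
      linarith
  refine ⟨m, hm1, hm.trans (by simp [two_mul]), ξ, fun j => sl (t j), fun j => c (t j), h0, hml,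
    hlt, fun j hj => ?_, ?_⟩
  · rw [← haff _ _ (ht j (by omega) (Set.right_mem_Icc.2 (hlt j (by omega)).le)),
      ← haff _ _ (ht (j + 1) hj (Set.left_mem_Icc.2 (hlt (j + 1) hj).le))]
  · rw [kLevel_eq_graph hg hgf hgk]
    ext ⟨x, y⟩
    simp only [Set.mem_ofPred_eq, Set.mem_iUnion, Finset.mem_range, exists_prop, hx]
    constructor
    · rintro ⟨⟨j, hj, hxj⟩, rfl⟩
      exact ⟨j, hj, hxj, haff _ _ (ht j hj hxj)⟩
    · rintro ⟨j, hj, hxj, rfl⟩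
      exact ⟨⟨j, hj, hxj⟩, (haff _ _ (ht j hj hxj)).symm⟩

end KLevelGeom
end
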